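/- Second a priori error estimate (Theorem 5.1, estimate (5.2)): There exists a constant C depending only on γ and ρ such that the error between the exact solution and the dG(0) approximation satisfies ‖U_{1,N} − u_1(T)‖ ≤ C Σ_{n=1}^N k_n ∫_{I_n} ( ‖u_2'(t)‖ + ‖A^{1/2} u_1'(t)‖ ) dt. -/

import Mathlib

open MeasureTheory Finset
open scoped RealInnerProductSpace

/-- The time step `k_n = t_n − t_{n-1}`. -/
noncomputable def kstep (tp : ℕ → ℝ) (n : ℕ) : ℝ := tp n - tp (n - 1)

/-- The quadrature weights
`ω_{n,j} = ∫_{I_n} ∫_{t_{j-1}}^{min(t_j, t)} β(t − s) ds dt` for `1 ≤ j ≤ n ≤ N`. -/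
noncomputable def qweight (β : ℝ → ℝ) (tp : ℕ → ℝ) (n j : ℕ) : ℝ :=
  ∫ t in (tp (n - 1))..(tp n), ∫ s in (tp (j - 1))..(min (tp j) t), β (t - s)

/-- Positivity of the discrete memory term: for a kernel that is monotone in the time index,
the backward difference quotient controls the final value. -/
theorem sum_inner_memory_ge {H : Type*} [NormedAddCommGroup H] [InnerProductSpace ℝ H]
    {N : ℕ} {a : ℕ → ℕ → ℝ} {γ : ℝ} {E : ℕ → H} (hE : E 0 = 0) (hγ1 : γ ≤ 1)
    (ha : ∀ n < N, ∀ j ≤ n, 0 ≤ a n j)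
    (hanti : ∀ n, n + 1 < N → ∀ j < n, a (n + 1) j ≤ a n j)
    (hsum : ∀ n, n + 1 < N → ∑ j ∈ range (n + 1), a n j ≤ ∑ j ∈ range (n + 1 + 1), a (n + 1) j)
    (hγ : ∀ n < N, ∑ j ∈ range (n + 1), a n j ≤ γ) {m : ℕ} (hm : m ≤ N) :
    (1 - γ) / 2 * ‖E m‖ ^ 2 ≤
      ∑ n ∈ range m, ⟪E (n + 1) - ∑ j ∈ range (n + 1), a n j • E (j + 1), E (n + 1) - E n⟫ := by
  have key : ∀ x y z : H, ⟪y - z, y - x⟫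
      = (‖y - z‖ ^ 2 - ‖x - z‖ ^ 2 + ‖y - x‖ ^ 2) / 2 := fun x y z ↦ by
    have h : x - z = (y - z) - (y - x) := by abel
    rw [h, norm_sub_sq_real (y - z) (y - x)]
    ring
  have key0 : ∀ x y : H, ⟪y, y - x⟫ = (‖y‖ ^ 2 - ‖x‖ ^ 2 + ‖y - x‖ ^ 2) / 2 := fun x y ↦ by
    simpa using key x y 0
  have split : ∀ n, ⟪E (n + 1) - ∑ j ∈ range (n + 1), a n j • E (j + 1), E (n + 1) - E n⟫
      = (1 - ∑ j ∈ range (n + 1), a n j) * ⟪E (n + 1), E (n + 1) - E n⟫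
        + ∑ j ∈ range n, a n j * ⟪E (n + 1) - E (j + 1), E (n + 1) - E n⟫ := fun n ↦ by
    have h : ∑ j ∈ range n, a n j * ⟪E (n + 1) - E (j + 1), E (n + 1) - E n⟫
        = ∑ j ∈ range (n + 1), a n j * ⟪E (n + 1) - E (j + 1), E (n + 1) - E n⟫ := by
      simp [sum_range_succ]
    rw [h, inner_sub_left, sum_inner]
    simp only [inner_sub_left (E (n + 1)) (E _), mul_sub, sum_sub_distrib, ← sum_mul,
      real_inner_smul_left]
    ring
  have main : ∀ k, k + 1 ≤ N →
      (1 - ∑ j ∈ range (k + 1), a k j) / 2 * ‖E (k + 1)‖ ^ 2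
        + ∑ j ∈ range (k + 1), a k j / 2 * ‖E (k + 1) - E (j + 1)‖ ^ 2 ≤
      ∑ n ∈ range (k + 1),
        ⟪E (n + 1) - ∑ j ∈ range (n + 1), a n j • E (j + 1), E (n + 1) - E n⟫ := by
    intro k
    induction k with
    | zero =>
      intro hk
      have h1 := hγ 0 hk
      simp only [zero_add, range_one, sum_singleton, sub_self, norm_zero, hE, sub_zero,
        inner_sub_left, real_inner_smul_left, real_inner_self_eq_norm_sq] at h1 ⊢
      nlinarith [sq_nonneg ‖E 1‖]
    | succ k ih =>
      intro hk
      have ih := ih (by omega)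
      have hlast : ∑ j ∈ range (k + 1 + 1), a (k + 1) j / 2 * ‖E (k + 1 + 1) - E (j + 1)‖ ^ 2
          = ∑ j ∈ range (k + 1), a (k + 1) j / 2 * ‖E (k + 1 + 1) - E (j + 1)‖ ^ 2 := by
        simp [sum_range_succ _ (k + 1)]
      have hstep : ∑ j ∈ range (k + 1), a (k + 1) j / 2 * ‖E (k + 1 + 1) - E (j + 1)‖ ^ 2
          ≤ ∑ j ∈ range (k + 1), a k j / 2 * ‖E (k + 1) - E (j + 1)‖ ^ 2
            + ∑ j ∈ range (k + 1), a (k + 1) j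
              * ⟪E (k + 1 + 1) - E (j + 1), E (k + 1 + 1) - E (k + 1)⟫ := by
        rw [← sum_add_distrib]
        refine sum_le_sum fun j hj ↦ ?_
        rw [key]
        have hj : j ≤ k := Nat.lt_succ_iff.mp (mem_range.mp hj)
        have h1 : a (k + 1) j * ‖E (k + 1) - E (j + 1)‖ ^ 2
            ≤ a k j * ‖E (k + 1) - E (j + 1)‖ ^ 2 := by
          rcases hj.lt_or_eq with hlt | rfl
          · exact mul_le_mul_of_nonneg_right (hanti k (by omega) j hlt) (sq_nonneg _)
          · simp
        have h2 := mul_nonneg (ha (k + 1) (by omega) j (by omega))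
          (sq_nonneg ‖E (k + 1 + 1) - E (k + 1)‖)
        linarith
      rw [hlast, sum_range_succ (fun n ↦ ⟪_, E (n + 1) - E n⟫) (k + 1), split (k + 1), key0]
      have h1 := mul_le_mul_of_nonneg_right (hsum k (by omega)) (sq_nonneg ‖E (k + 1)‖)
      have h2 := mul_nonneg (sub_nonneg.mpr ((hγ (k + 1) (by omega)).trans hγ1))
        (sq_nonneg ‖E (k + 1 + 1) - E (k + 1)‖)
      linarith
  rcases m with _ | k
  · simp [hE]
  · refine le_trans ?_ (main k hm)
    have h1 : 0 ≤ ∑ j ∈ range (k + 1), a k j / 2 * ‖E (k + 1) - E (j + 1)‖ ^ 2 :=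
      sum_nonneg fun j hj ↦ mul_nonneg (div_nonneg
        (ha k hm j (Nat.lt_succ_iff.mp (mem_range.mp hj))) zero_le_two) (sq_nonneg _)
    have h2 := mul_le_mul_of_nonneg_right (hγ k hm) (sq_nonneg ‖E (k + 1)‖)
    linarith

/-- Stability of the implicit Euler scheme with memory in the energy norm. -/
theorem norm_le_of_discrete_energy {H : Type*} [NormedAddCommGroup H] [InnerProductSpace ℝ H]
    {N : ℕ} {a : ℕ → ℕ → ℝ} {γ ρ : ℝ} {E G X r s : ℕ → H}
    (hγ1 : γ < 1) (hρ : 0 < ρ) (hE : E 0 = 0) (hG : G 0 = 0)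
    (ha : ∀ n < N, ∀ j ≤ n, 0 ≤ a n j)
    (hanti : ∀ n, n + 1 < N → ∀ j < n, a (n + 1) j ≤ a n j)
    (hsum : ∀ n, n + 1 < N → ∑ j ∈ range (n + 1), a n j ≤ ∑ j ∈ range (n + 1 + 1), a (n + 1) j)
    (hγ : ∀ n < N, ∑ j ∈ range (n + 1), a n j ≤ γ)
    (hX : ∀ n < N, X n = E (n + 1) - ∑ j ∈ range (n + 1), a n j • E (j + 1))
    (henergy : ∀ n < N, ρ * ⟪G (n + 1) - G n, G (n + 1)⟫ + ⟪X n, E (n + 1) - E n - r n⟫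
      = ⟪s n, G (n + 1)⟫) :
    ‖E N‖ ≤ 4 / min (1 - γ) ρ * ∑ n ∈ range N, (‖r n‖ + ‖s n‖) := by
  set κ := min (1 - γ) ρ with hκ
  have hκ0 : 0 < κ := lt_min (by linarith) hρ
  set S := ∑ n ∈ range N, (‖r n‖ + ‖s n‖) with hS
  have hS0 : 0 ≤ S := sum_nonneg fun n _ ↦ by positivity
  obtain ⟨m, hm, hmax⟩ := exists_max_image (range (N + 1)) (fun m ↦ ‖E m‖ ^ 2 + ‖G m‖ ^ 2)
    ⟨0, by simp⟩
  have hm : m ≤ N := Nat.lt_succ_iff.mp (mem_range.mp hm)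
  set M := √(‖E m‖ ^ 2 + ‖G m‖ ^ 2) with hM
  have hM0 : 0 ≤ M := Real.sqrt_nonneg _
  have hM2 : M ^ 2 = ‖E m‖ ^ 2 + ‖G m‖ ^ 2 := Real.sq_sqrt (by positivity)
  have hEM : ∀ n ≤ N, ‖E n‖ ≤ M := fun n hn ↦ by
    have h := hmax n (mem_range.mpr (by omega))
    exact Real.le_sqrt_of_sq_le (by nlinarith [sq_nonneg ‖G n‖])
  have hGM : ∀ n ≤ N, ‖G n‖ ≤ M := fun n hn ↦ by
    have h := hmax n (mem_range.mpr (by omega))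
    exact Real.le_sqrt_of_sq_le (by nlinarith [sq_nonneg ‖E n‖])
  have hXM : ∀ n < N, ‖X n‖ ≤ 2 * M := fun n hn ↦ by
    rw [hX n hn]
    have h : ‖∑ j ∈ range (n + 1), a n j • E (j + 1)‖ ≤ ∑ j ∈ range (n + 1), a n j * M :=
      norm_sum_le_of_le _ fun j hj ↦ by
        have hj : j ≤ n := Nat.lt_succ_iff.mp (mem_range.mp hj)
        rw [norm_smul, Real.norm_of_nonneg (ha n hn j hj)]
        exact mul_le_mul_of_nonneg_left (hEM _ (by omega)) (ha n hn j hj)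
    rw [← sum_mul] at h
    have h1 := norm_sub_le (E (n + 1)) (∑ j ∈ range (n + 1), a n j • E (j + 1))
    have h2 := hEM (n + 1) hn
    have h3 := mul_le_mul_of_nonneg_right ((hγ n hn).trans hγ1.le) hM0
    linarith
  have hGsum : ρ / 2 * ‖G m‖ ^ 2 ≤ ∑ n ∈ range m, ρ * ⟪G (n + 1) - G n, G (n + 1)⟫ := by
    have h : ∑ n ∈ range m, ρ / 2 * (‖G (n + 1)‖ ^ 2 - ‖G n‖ ^ 2) = ρ / 2 * ‖G m‖ ^ 2 := by
      rw [← mul_sum, sum_range_sub (fun n ↦ ‖G n‖ ^ 2)]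
      simp [hG]
    rw [← h]
    refine sum_le_sum fun n _ ↦ ?_
    have h1 : ‖G n‖ ^ 2 = ‖G (n + 1) - (G (n + 1) - G n)‖ ^ 2 := by simp
    rw [h1, norm_sub_sq_real, real_inner_comm]
    nlinarith [sq_nonneg ‖G (n + 1) - G n‖]
  have hEsum := sum_inner_memory_ge hE hγ1.le ha hanti hsum hγ hm
  have hbound : ∑ n ∈ range m, ρ * ⟪G (n + 1) - G n, G (n + 1)⟫
      + ∑ n ∈ range m,
        ⟪E (n + 1) - ∑ j ∈ range (n + 1), a n j • E (j + 1), E (n + 1) - E n⟫ ≤ 2 * M * S := by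
    rw [← sum_add_distrib, hS, mul_sum]
    refine (sum_le_sum fun n hn ↦ ?_).trans (sum_le_sum_of_subset_of_nonneg
      (range_mono hm) fun n _ _ ↦ by positivity)
    have hn : n < N := (mem_range.mp hn).trans_le hm
    have h := henergy n hn
    rw [inner_sub_right] at h
    rw [← hX n hn]
    have h1 := (real_inner_le_norm (X n) (r n)).trans
      (mul_le_mul_of_nonneg_right (hXM n hn) (norm_nonneg _))
    have h2 := (real_inner_le_norm (s n) (G (n + 1))).trans
      (mul_le_mul_of_nonneg_left (hGM (n + 1) hn) (norm_nonneg _))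
    nlinarith [mul_nonneg hM0 (norm_nonneg (s n))]
  have hquad : κ * M ^ 2 ≤ 4 * S * M := by
    have h1 := mul_le_mul_of_nonneg_right (min_le_left (1 - γ) ρ) (sq_nonneg ‖E m‖)
    have h2 := mul_le_mul_of_nonneg_right (min_le_right (1 - γ) ρ) (sq_nonneg ‖G m‖)
    rw [hM2]
    rw [← hκ] at h1 h2
    linarith
  refine (hEM N le_rfl).trans ?_
  rw [div_mul_eq_mul_div, le_div_iff₀ hκ0]
  rcases hM0.eq_or_lt with h | h
  · rw [← h]; linarith
  · exact le_of_mul_le_mul_right (by nlinarith) h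

theorem integral_comp_sub_eq_primitive_sub {b : ℝ → ℝ} (hb : Integrable b) (p q t : ℝ) :
    ∫ s in p..q, b (t - s) = (∫ x in (0:ℝ)..(t - p), b x) - ∫ x in (0:ℝ)..(t - q), b x := by
  rw [intervalIntegral.integral_comp_sub_left b t,
    intervalIntegral.integral_interval_sub_left hb.intervalIntegrable hb.intervalIntegrable]

theorem continuous_integral_comp_sub {b : ℝ → ℝ} (hb : Integrable b) (p q : ℝ) :
    Continuous fun t ↦ ∫ s in p..q, b (t - s) := by
  have h := intervalIntegral.continuous_primitive (fun _ _ ↦ hb.intervalIntegrable) (0:ℝ)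
  simp only [integral_comp_sub_eq_primitive_sub hb]
  fun_prop

theorem integral_comp_sub_nonneg {b : ℝ → ℝ} (hb0 : ∀ x, 0 ≤ b x) {p q : ℝ} (hpq : p ≤ q)
    (t : ℝ) : 0 ≤ ∫ s in p..q, b (t - s) :=
  intervalIntegral.integral_nonneg hpq fun _ _ ↦ hb0 _

theorem integral_comp_sub_antitoneOn {b : ℝ → ℝ} (hb : Integrable b)
    (hanti : AntitoneOn b (Set.Ioi 0)) {p q : ℝ} (hpq : p ≤ q) :
    AntitoneOn (fun t ↦ ∫ s in p..q, b (t - s)) (Set.Ici q) := by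
  intro t ht t' ht' htt'
  refine intervalIntegral.integral_mono_on_of_le_Ioo hpq (hb.comp_sub_left t').intervalIntegrable
    (hb.comp_sub_left t).intervalIntegrable fun s hs ↦ hanti ?_ ?_ (by linarith)
  · exact sub_pos.mpr (hs.2.trans_le ht)
  · exact sub_pos.mpr (hs.2.trans_le ht')

theorem primitive_le_integral {b : ℝ → ℝ} (hb : Integrable b) (hb0 : ∀ x, 0 ≤ b x) (x : ℝ) :
    ∫ y in (0:ℝ)..x, b y ≤ ∫ y, b y := by
  calc ∫ y in (0:ℝ)..x, b y ≤ ‖∫ y in (0:ℝ)..x, b y‖ := Real.le_norm_self _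
    _ ≤ ∫ y in Set.uIoc 0 x, ‖b y‖ := intervalIntegral.norm_integral_le_integral_norm_uIoc
    _ = ∫ y in Set.uIoc 0 x, b y := by simp only [Real.norm_eq_abs, abs_of_nonneg, hb0]
    _ ≤ ∫ y, b y := setIntegral_le_integral hb (.of_forall hb0)

theorem primitive_nonneg {b : ℝ → ℝ} (hb0 : ∀ x, 0 ≤ b x) (hbz : ∀ x ≤ 0, b x = 0) (x : ℝ) :
    0 ≤ ∫ y in (0:ℝ)..x, b y := by
  rcases le_total 0 x with h | h
  · exact intervalIntegral.integral_nonneg h fun _ _ ↦ hb0 _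
  · rw [intervalIntegral.integral_zero_ae (.of_forall fun y hy ↦ hbz y ?_)]
    rw [Set.uIoc_of_ge h] at hy
    exact hy.2

theorem integral_integral_comp_sub_le {b : ℝ → ℝ} (hb : Integrable b) (hb0 : ∀ x, 0 ≤ b x)
    (hbz : ∀ x ≤ 0, b x = 0) {p q : ℝ} (hpq : p ≤ q) (T : ℝ) :
    ∫ t in (0:ℝ)..T, ∫ s in p..q, b (t - s) ≤ (∫ y, b y) * (q - p) := by
  have hB := intervalIntegral.continuous_primitive (fun _ _ ↦ hb.intervalIntegrable) (0:ℝ)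
  set B : ℝ → ℝ := fun x ↦ ∫ y in (0:ℝ)..x, b y with hBdef
  have hint : ∀ x y, IntervalIntegrable B volume x y := fun x y ↦ hB.intervalIntegrable x y
  have h1 : ∫ t in (0:ℝ)..T, ∫ s in p..q, b (t - s)
      = (∫ x in (T - q)..(T - p), B x) - ∫ x in (0 - q)..(0 - p), B x := by
    have hshift : ∀ c, IntervalIntegrable (fun t ↦ B (t - c)) volume 0 T := fun c ↦
      (hB.comp (continuous_sub_right c)).intervalIntegrable _ _
    have h : ∫ t in (0:ℝ)..T, ∫ s in p..q, b (t - s) = ∫ t in (0:ℝ)..T, (B (t - p) - B (t - q)) := by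
      simp only [integral_comp_sub_eq_primitive_sub hb, hBdef]
    rw [h, intervalIntegral.integral_sub (hshift p) (hshift q),
      intervalIntegral.integral_comp_sub_right B p, intervalIntegral.integral_comp_sub_right B q,
      intervalIntegral.integral_interval_sub_interval_comm' (hint _ _) (hint _ _) (hint _ _)]
  have h2 : ∫ x in (T - q)..(T - p), B x ≤ ∫ x in (T - q)..(T - p), ∫ y, b y :=
    intervalIntegral.integral_mono_on (by linarith) (hint _ _) (by simp)
      fun x _ ↦ primitive_le_integral hb hb0 x
  have h3 : 0 ≤ ∫ x in (0 - q)..(0 - p), B x :=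
    intervalIntegral.integral_nonneg (by linarith) fun x _ ↦ primitive_nonneg hb0 hbz x
  rw [intervalIntegral.integral_const, smul_eq_mul] at h2
  rw [h1]
  linarith

/-- Mean values over adjacent intervals inherit monotonicity of the integrand. -/
theorem inv_mul_integral_le_of_forall_le {g : ℝ → ℝ} (hg : Continuous g) {x y z : ℝ}
    (hxy : x < y) (hyz : y < z) (h1 : ∀ t ∈ Set.Icc x y, g y ≤ g t)
    (h2 : ∀ t ∈ Set.Icc y z, g t ≤ g y) :
    (z - y)⁻¹ * ∫ t in y..z, g t ≤ (y - x)⁻¹ * ∫ t in x..y, g t := by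
  have h3 := intervalIntegral.integral_mono_on hyz.le (hg.intervalIntegrable (μ := volume) y z)
    (intervalIntegrable_const (c := g y)) h2
  have h4 := intervalIntegral.integral_mono_on hxy.le (intervalIntegrable_const (c := g y))
    (hg.intervalIntegrable (μ := volume) x y) h1
  rw [intervalIntegral.integral_const, smul_eq_mul] at h3 h4
  have hy : 0 < y - x := sub_pos.mpr hxy
  have hz : 0 < z - y := sub_pos.mpr hyz
  calc (z - y)⁻¹ * ∫ t in y..z, g t ≤ g y := by
        rw [inv_mul_le_iff₀ hz]; exact h3
    _ ≤ (y - x)⁻¹ * ∫ t in x..y, g t := by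
        rw [le_inv_mul_iff₀ hy]; exact h4

section Convolution

variable {H : Type*} [NormedAddCommGroup H] [NormedSpace ℝ H]

theorem intervalIntegrable_comp_sub_smul {b : ℝ → ℝ} (hb : Integrable b) {v : ℝ → H} {p q : ℝ}
    (hpq : p ≤ q) (hv : ContinuousOn v (Set.Icc p q)) (t : ℝ) :
    IntervalIntegrable (fun s ↦ b (t - s) • v s) volume p q := by
  rw [intervalIntegrable_iff_integrableOn_Icc_of_le hpq]
  exact (hb.comp_sub_left t).integrableOn.smul_continuousOn hv isCompact_Icc

theorem integrable_integral_comp_sub_smul [CompleteSpace H] {b : ℝ → ℝ} (hb : Integrable b)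
    {v : ℝ → H} {p q : ℝ} (hpq : p ≤ q) (hv : ContinuousOn v (Set.Icc p q)) :
    Integrable fun t ↦ ∫ s in p..q, b (t - s) • v s := by
  have hvi : Integrable ((Set.Ioc p q).indicator v) := by
    rw [integrable_indicator_iff measurableSet_Ioc]
    exact (hv.integrableOn_compact isCompact_Icc).mono_set Set.Ioc_subset_Icc_self
  refine (hb.integrable_convolution (ContinuousLinearMap.lsmul ℝ ℝ) hvi).congr (.of_forall fun t ↦ ?_)
  simp only
  rw [convolution_lsmul_swap, intervalIntegral.integral_of_le hpq,
    ← integral_indicator measurableSet_Ioc]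
  congr 1 with s
  by_cases hs : s ∈ Set.Ioc p q <;> simp [hs]

theorem integral_eq_sub_of_hasDerivWithinAt_Icc [CompleteSpace H] {v v' : ℝ → H} {p q : ℝ}
    (hpq : p ≤ q) (hv : ∀ t ∈ Set.Icc p q, HasDerivWithinAt v (v' t) (Set.Icc p q) t)
    (hv' : ContinuousOn v' (Set.Icc p q)) :
    ∫ t in p..q, v' t = v q - v p :=
  intervalIntegral.integral_eq_sub_of_hasDerivAt_of_le hpq
    (fun t ht ↦ (hv t ht).continuousWithinAt)
    (fun t ht ↦ (hv t (Set.Ioo_subset_Icc_self ht)).hasDerivAt (Icc_mem_nhds ht.1 ht.2))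
    (hv'.intervalIntegrable_of_Icc hpq)

theorem norm_sub_le_integral_norm_deriv [CompleteSpace H] {v v' : ℝ → H} {p q s : ℝ}
    (hs : s ∈ Set.Icc p q)
    (hv : ∀ t ∈ Set.Icc p q, HasDerivWithinAt v (v' t) (Set.Icc p q) t)
    (hv' : ContinuousOn v' (Set.Icc p q)) :
    ‖v q - v s‖ ≤ ∫ t in p..q, ‖v' t‖ := by
  have hsub : Set.Icc s q ⊆ Set.Icc p q := Set.Icc_subset_Icc_left hs.1
  rw [← integral_eq_sub_of_hasDerivWithinAt_Icc hs.2 (fun t ht ↦ (hv t (hsub ht)).mono hsub)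
    (hv'.mono hsub)]
  refine (intervalIntegral.norm_integral_le_integral_norm hs.2).trans ?_
  exact intervalIntegral.integral_mono_interval hs.1 hs.2 le_rfl
    (.of_forall fun _ ↦ norm_nonneg _) (hv'.norm.intervalIntegrable_of_Icc (hs.1.trans hs.2))

theorem norm_smul_sub_integral_le [CompleteSpace H] {v v' : ℝ → H} {p q : ℝ} (hpq : p ≤ q)
    (hv : ∀ t ∈ Set.Icc p q, HasDerivWithinAt v (v' t) (Set.Icc p q) t)
    (hv' : ContinuousOn v' (Set.Icc p q)) :
    ‖(q - p) • v q - ∫ t in p..q, v t‖ ≤ (q - p) * ∫ t in p..q, ‖v' t‖ := by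
  have hvc : ContinuousOn v (Set.Icc p q) := fun t ht ↦ (hv t ht).continuousWithinAt
  rw [← intervalIntegral.integral_const, ← intervalIntegral.integral_sub intervalIntegrable_const
    (hvc.intervalIntegrable_of_Icc hpq), mul_comm, ← abs_of_nonneg (sub_nonneg.mpr hpq)]
  refine intervalIntegral.norm_integral_le_of_norm_le_const fun s hs ↦ ?_
  rw [Set.uIoc_of_le hpq] at hs
  exact norm_sub_le_integral_norm_deriv (Set.Ioc_subset_Icc_self hs) hv hv'

theorem norm_integral_integral_comp_sub_smul_le [CompleteSpace H] {b : ℝ → ℝ} (hb : Integrable b)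
    (hb0 : ∀ x, 0 ≤ b x) {v v' : ℝ → H} {p q x y : ℝ} (hpq : p ≤ q) (hxy : x ≤ y)
    (hv : ∀ t ∈ Set.Icc p q, HasDerivWithinAt v (v' t) (Set.Icc p q) t)
    (hv' : ContinuousOn v' (Set.Icc p q)) :
    ‖∫ t in x..y, ∫ s in p..q, b (t - s) • (v q - v s)‖
      ≤ (∫ t in x..y, ∫ s in p..q, b (t - s)) * ∫ t in p..q, ‖v' t‖ := by
  rw [← intervalIntegral.integral_mul_const]
  refine intervalIntegral.norm_integral_le_of_norm_le hxy (.of_forall fun t _ ↦ ?_)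
    (((continuous_integral_comp_sub hb p q).mul_const _).intervalIntegrable _ _)
  rw [← intervalIntegral.integral_mul_const]
  refine intervalIntegral.norm_integral_le_of_norm_le hpq (.of_forall fun s hs ↦ ?_)
    ((hb.comp_sub_left t).intervalIntegrable.mul_const _)
  rw [norm_smul, Real.norm_of_nonneg (hb0 _)]
  exact mul_le_mul_of_nonneg_left
    (norm_sub_le_integral_norm_deriv (Set.Ioc_subset_Icc_self hs) hv hv') (hb0 _)

/-- Causality: convolving up to the present time is convolving with the zero extension of the
kernel. -/
theorem integral_min_comp_sub_smul (β : ℝ → ℝ) (v : ℝ → H) {p q t : ℝ} (hpq : p ≤ q)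
    (hpt : p ≤ t) :
    ∫ s in p..(min q t), β (t - s) • v s
      = ∫ s in p..q, (Set.Ioi 0).indicator β (t - s) • v s := by
  rw [intervalIntegral.integral_of_le (le_min hpq hpt), intervalIntegral.integral_of_le hpq,
    ← Set.Ioc_inter_Iic, ← setIntegral_indicator measurableSet_Iic]
  refine integral_congr_ae ((ae_restrict_of_ae (Measure.ae_ne volume t)).mono fun s hs ↦ ?_)
  rcases lt_or_gt_of_ne hs with h | h
  · simp [h.le, h]
  · simp [h, h.le]

end Convolution

/-- The integrated evolution equation, with the memory term split into its piecewise constant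
quadrature and a remainder. -/
theorem integrated_memory_equation {H : Type*} [NormedAddCommGroup H] [NormedSpace ℝ H]
    [CompleteSpace H] {β b : ℝ → ℝ} (hbβ : b = (Set.Ioi 0).indicator β) (hb : Integrable b)
    {tp : ℕ → ℝ} {n : ℕ} (htp0 : tp 0 = 0) (htp : ∀ j ≤ n, tp j ≤ tp (j + 1)) (A : H →L[ℝ] H)
    {ρ : ℝ} {f u1 u2 u2d : ℝ → H} (hu1 : ContinuousOn u1 (Set.Icc 0 (tp (n + 1))))
    (hu2 : ∀ t ∈ Set.Icc (tp n) (tp (n + 1)),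
      HasDerivWithinAt u2 (u2d t) (Set.Icc (tp n) (tp (n + 1))) t)
    (hu2d : ContinuousOn u2d (Set.Icc (tp n) (tp (n + 1))))
    (heq : ∀ t ∈ Set.Icc (tp n) (tp (n + 1)),
      ρ • u2d t + A (u1 t) - ∫ s in (0:ℝ)..t, β (t - s) • A (u1 s) = f t) :
    ρ • (u2 (tp (n + 1)) - u2 (tp n)) + A ((∫ t in (tp n)..(tp (n + 1)), u1 t)
      - ∑ j ∈ range (n + 1),
        ((∫ t in (tp n)..(tp (n + 1)), ∫ s in (tp j)..(tp (j + 1)), b (t - s)) • u1 (tp (j + 1))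
          - ∫ t in (tp n)..(tp (n + 1)), ∫ s in (tp j)..(tp (j + 1)),
            b (t - s) • (u1 (tp (j + 1)) - u1 s)))
      = ∫ t in (tp n)..(tp (n + 1)), f t := by
  have hmono : ∀ i j, i ≤ j → j ≤ n + 1 → tp i ≤ tp j := fun i j hij ↦ by
    induction j, hij using Nat.le_induction with
    | base => exact fun _ ↦ le_rfl
    | succ j _ ih => exact fun hj ↦ (ih (by omega)).trans (htp j (by omega))
  have htn : tp n ≤ tp (n + 1) := htp n le_rfl
  have h0n : 0 ≤ tp n := htp0 ▸ hmono 0 n (by omega) (by omega)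
  have hsub : ∀ j ≤ n, Set.Icc (tp j) (tp (j + 1)) ⊆ Set.Icc 0 (tp (n + 1)) := fun j hj ↦
    Set.Icc_subset_Icc (htp0 ▸ hmono 0 j (by omega) (by omega)) (hmono _ _ (by omega) le_rfl)
  have hdiff : ∀ j ≤ n, ContinuousOn (fun s ↦ u1 (tp (j + 1)) - u1 s)
      (Set.Icc (tp j) (tp (j + 1))) := fun j hj ↦ continuousOn_const.sub (hu1.mono (hsub j hj))
  have hAu : ContinuousOn (fun s ↦ A (u1 s)) (Set.Icc 0 (tp (n + 1))) :=
    A.continuous.comp_continuousOn hu1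
  have hmem : ∀ t ∈ Set.Icc (tp n) (tp (n + 1)), ∫ s in (0:ℝ)..t, β (t - s) • A (u1 s)
      = A (∑ j ∈ range (n + 1), ((∫ s in (tp j)..(tp (j + 1)), b (t - s)) • u1 (tp (j + 1))
          - ∫ s in (tp j)..(tp (j + 1)), b (t - s) • (u1 (tp (j + 1)) - u1 s))) := by
    intro t ht
    have h1 := integral_min_comp_sub_smul β (fun s ↦ A (u1 s)) (h0n.trans htn) (h0n.trans ht.1)
    rw [min_eq_right ht.2, ← hbβ, ← htp0, ← intervalIntegral.sum_integral_adjacent_intervals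
      fun j hj ↦ intervalIntegrable_comp_sub_smul hb (htp j (by omega))
        (hAu.mono (hsub j (by omega))) t] at h1
    rw [← htp0, h1, map_sum]
    refine sum_congr rfl fun j hj ↦ ?_
    have hj : j ≤ n := Nat.lt_succ_iff.mp (mem_range.mp hj)
    have hint := intervalIntegrable_comp_sub_smul hb (htp j hj) (hdiff j hj) t
    rw [← intervalIntegral.integral_smul_const, ← intervalIntegral.integral_sub
      (intervalIntegrable_comp_sub_smul hb (htp j hj) continuousOn_const t) hint,
      ← A.intervalIntegral_comp_comm
      ((intervalIntegrable_comp_sub_smul hb (htp j hj) continuousOn_const t).sub hint)]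
    refine intervalIntegral.integral_congr fun s _ ↦ ?_
    simp [smul_sub]
  have hint1 : IntervalIntegrable u1 volume (tp n) (tp (n + 1)) :=
    (hu1.mono (hsub n le_rfl)).intervalIntegrable_of_Icc htn
  have hint2 : ∀ j ∈ range (n + 1), IntervalIntegrable
      (fun t ↦ (∫ s in (tp j)..(tp (j + 1)), b (t - s)) • u1 (tp (j + 1))) volume
      (tp n) (tp (n + 1)) := fun j _ ↦
    ((continuous_integral_comp_sub hb _ _).smul continuous_const).intervalIntegrable _ _
  have hint3 : ∀ j ∈ range (n + 1), IntervalIntegrable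
      (fun t ↦ ∫ s in (tp j)..(tp (j + 1)), b (t - s) • (u1 (tp (j + 1)) - u1 s)) volume
      (tp n) (tp (n + 1)) := fun j hj ↦
    have hj : j ≤ n := Nat.lt_succ_iff.mp (mem_range.mp hj)
    (integrable_integral_comp_sub_smul hb (htp j hj) (hdiff j hj)).intervalIntegrable
  have hint4 := fun j hj ↦ (hint2 j hj).sub (hint3 j hj)
  have hint5 : IntervalIntegrable (fun t ↦ ∑ j ∈ range (n + 1),
      ((∫ s in (tp j)..(tp (j + 1)), b (t - s)) • u1 (tp (j + 1))
        - ∫ s in (tp j)..(tp (j + 1)), b (t - s) • (u1 (tp (j + 1)) - u1 s)))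
      volume (tp n) (tp (n + 1)) := by
    simpa only [Finset.sum_fn] using IntervalIntegrable.sum _ hint4
  have hf : ∀ t ∈ Set.uIcc (tp n) (tp (n + 1)), f t = ρ • u2d t + A (u1 t
      - ∑ j ∈ range (n + 1), ((∫ s in (tp j)..(tp (j + 1)), b (t - s)) • u1 (tp (j + 1))
          - ∫ s in (tp j)..(tp (j + 1)), b (t - s) • (u1 (tp (j + 1)) - u1 s))) := by
    intro t ht
    rw [Set.uIcc_of_le htn] at ht
    rw [← heq t ht, hmem t ht, map_sub, add_sub_assoc]
  have hu2i : IntervalIntegrable (fun t ↦ ρ • u2d t) volume (tp n) (tp (n + 1)) :=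
    (hu2d.intervalIntegrable_of_Icc htn).smul ρ
  rw [intervalIntegral.integral_congr hf, intervalIntegral.integral_add hu2i
    ⟨A.integrable_comp (hint1.sub hint5).1, A.integrable_comp (hint1.sub hint5).2⟩,
    intervalIntegral.integral_smul, integral_eq_sub_of_hasDerivWithinAt_Icc htn hu2 hu2d,
    A.intervalIntegral_comp_comm (hint1.sub hint5), intervalIntegral.integral_sub hint1 hint5,
    intervalIntegral.integral_finsetSum hint4]
  congr 3
  refine sum_congr rfl fun j hj ↦ ?_
  rw [intervalIntegral.integral_sub (hint2 j hj) (hint3 j hj),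
    intervalIntegral.integral_smul_const]

theorem sum_Icc_one_eq_sum_range {M : Type*} [AddCommMonoid M] (g : ℕ → M) (N : ℕ) :
    ∑ n ∈ Icc 1 N, g n = ∑ n ∈ range N, g (n + 1) := by
  rw [range_eq_Ico, sum_Ico_add' g 0 N 1]
  rfl

theorem qweight_succ_eq {β : ℝ → ℝ} {tp : ℕ → ℝ} {n j : ℕ} (hn : tp n ≤ tp (n + 1))
    (hj : tp j ≤ tp (j + 1)) (hjn : tp j ≤ tp n) :
    qweight β tp (n + 1) (j + 1)
      = ∫ t in (tp n)..(tp (n + 1)), ∫ s in (tp j)..(tp (j + 1)),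
          (Set.Ioi 0).indicator β (t - s) := by
  refine intervalIntegral.integral_congr fun t ht ↦ ?_
  simp only [add_tsub_cancel_right, Set.uIcc_of_le hn] at ht
  simpa using integral_min_comp_sub_smul β (fun _ ↦ (1:ℝ)) hj (hjn.trans ht.1)

/-- Second a priori error estimate (Theorem 5.1, estimate (5.2)): there is a
constant `C` depending only on `γ` and `ρ` such that
`‖U_{1,N} − u_1(T)‖ ≤ C Σ_{n=1}^N k_n ∫_{I_n} (‖u_2'‖ + ‖A^{1/2} u_1'‖) dt`.
Here `sqrtA` is the positive square root `A^{1/2}` of `A`, and `u1d`, `u2d`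
denote the derivatives of the exact solution `u_1`, `u_2`. -/
theorem dG0_apriori_error_second.{u} (γ ρ : ℝ) (hγ0 : 0 < γ) (hγ1 : γ < 1) (hρ : 0 < ρ) :
    ∃ C : ℝ, 0 < C ∧
      ∀ (H : Type u) [NormedAddCommGroup H] [InnerProductSpace ℝ H] [CompleteSpace H],
      ∀ (N : ℕ), 1 ≤ N → ∀ (tp : ℕ → ℝ), tp 0 = 0 → (∀ n < N, tp n < tp (n + 1)) →
      ∀ (β : ℝ → ℝ), (∀ s ∈ Set.Ioi (0:ℝ), 0 ≤ β s) → AntitoneOn β (Set.Ioi 0) →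
        LocallyIntegrableOn β (Set.Ioi 0) → (∫ s in Set.Ioi (0:ℝ), β s) = γ →
      ∀ (A sqrtA : H →L[ℝ] H),
        (∀ x y : H, ⟪A x, y⟫ = ⟪x, A y⟫) →
        (∃ c > 0, ∀ x : H, c * ‖x‖ ^ 2 ≤ ⟪A x, x⟫) →
        (∀ x y : H, ⟪sqrtA x, y⟫ = ⟪x, sqrtA y⟫) →
        (∀ x : H, 0 ≤ ⟪sqrtA x, x⟫) →
        (∀ x : H, sqrtA (sqrtA x) = A x) →
      ∀ (f : ℝ → H), IntegrableOn f (Set.Icc 0 (tp N)) →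
      ∀ (u1 u2 u1d u2d : ℝ → H),
        (∀ t ∈ Set.Icc (0:ℝ) (tp N), HasDerivWithinAt u1 (u1d t) (Set.Icc 0 (tp N)) t) →
        (∀ t ∈ Set.Icc (0:ℝ) (tp N), HasDerivWithinAt u2 (u2d t) (Set.Icc 0 (tp N)) t) →
        ContinuousOn u1d (Set.Icc 0 (tp N)) →
        ContinuousOn u2d (Set.Icc 0 (tp N)) →
        (∀ t ∈ Set.Icc (0:ℝ) (tp N), u1d t = u2 t) →
        (∀ t ∈ Set.Icc (0:ℝ) (tp N),
          ρ • u2d t + A (u1 t) - ∫ s in (0:ℝ)..t, β (t - s) • A (u1 s) = f t) →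
      ∀ (U1 U2 : ℕ → H), U1 0 = u1 0 → U2 0 = u2 0 →
        (∀ n : ℕ, 1 ≤ n → n ≤ N → U1 n - U1 (n - 1) = kstep tp n • U2 n) →
        (∀ n : ℕ, 1 ≤ n → n ≤ N →
          ρ • (U2 n - U2 (n - 1)) + (kstep tp n - qweight β tp n n) • A (U1 n)
              - ∑ j ∈ Finset.Ico 1 n, qweight β tp n j • A (U1 j)
            = ∫ t in (tp (n - 1))..(tp n), f t) →
      ‖U1 N - u1 (tp N)‖
        ≤ C * ∑ n ∈ Finset.Icc 1 N, kstep tp n *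
            ∫ t in (tp (n - 1))..(tp n), (‖u2d t‖ + ‖sqrtA (u1d t)‖) := by
  refine ⟨8 / min (1 - γ) ρ, div_pos (by norm_num) (lt_min (by linarith) hρ), ?_⟩
  intro H _ _ _ N _ tp htp0 htp β hβ0 hβanti _ hβγ A S hA _ hS _ hSA f _ u1 u2 u1d u2d hu1 hu2
    hu1d hu2d hu12 heq U1 U2 hU10 hU20 hU1 hU2
  have hmono : ∀ i j, i ≤ j → j ≤ N → tp i ≤ tp j := fun i j hij ↦ by
    induction j, hij using Nat.le_induction with
    | base => exact fun _ ↦ le_rfl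
    | succ j _ ih => exact fun hj ↦ (ih (by omega)).trans (htp j (by omega)).le
  have hsub : ∀ n < N, Set.Icc (tp n) (tp (n + 1)) ⊆ Set.Icc 0 (tp N) := fun n hn ↦
    Set.Icc_subset_Icc (htp0 ▸ hmono 0 n (by omega) (by omega)) (hmono _ _ (by omega) le_rfl)
  -- the kernel extended by zero
  set b : ℝ → ℝ := (Set.Ioi 0).indicator β with hbβ
  have hb : Integrable b := by
    rw [hbβ, integrable_indicator_iff measurableSet_Ioi]
    by_contra h
    rw [integral_undef h] at hβγ
    exact hγ0.ne hβγ
  have hbγ : ∫ x, b x = γ := by rw [hbβ, integral_indicator measurableSet_Ioi, hβγ]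
  have hb0 : ∀ x, 0 ≤ b x := Set.indicator_nonneg hβ0
  have hbz : ∀ x ≤ 0, b x = 0 := fun x hx ↦ Set.indicator_of_notMem (not_lt.mpr hx) β
  have hbanti : AntitoneOn b (Set.Ioi 0) :=
    hβanti.congr fun x hx ↦ (Set.indicator_of_mem hx β).symm
  set k : ℕ → ℝ := fun n ↦ tp (n + 1) - tp n with hk
  have hk0 : ∀ n < N, 0 < k n := fun n hn ↦ sub_pos.mpr (htp n hn)
  set ω : ℕ → ℕ → ℝ := fun n j ↦
    ∫ t in (tp n)..(tp (n + 1)), ∫ s in (tp j)..(tp (j + 1)), b (t - s) with hω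
  have hω0 : ∀ n < N, ∀ j < N, 0 ≤ ω n j := fun n hn j hj ↦
    intervalIntegral.integral_nonneg (htp n hn).le fun t _ ↦
      integral_comp_sub_nonneg hb0 (htp j hj).le t
  have hωsum : ∀ n < N, ∑ j ∈ range (n + 1), ω n j
      = ∫ t in (tp n)..(tp (n + 1)), ∫ x in (0:ℝ)..t, b x := fun n hn ↦ by
    simp only [hω]
    rw [← intervalIntegral.integral_finsetSum fun j _ ↦
      (continuous_integral_comp_sub hb _ _).intervalIntegrable _ _]
    refine intervalIntegral.integral_congr fun t ht ↦ ?_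
    rw [Set.uIcc_of_le (htp n hn).le] at ht
    rw [intervalIntegral.sum_integral_adjacent_intervals
      fun j _ ↦ (hb.comp_sub_left t).intervalIntegrable, integral_comp_sub_eq_primitive_sub hb,
      htp0, sub_zero, sub_eq_self]
    refine intervalIntegral.integral_zero_ae (.of_forall fun y hy ↦ hbz y ?_)
    rw [Set.uIoc_of_ge (sub_nonpos.mpr ht.2)] at hy
    exact hy.2
  have hB : Continuous fun t ↦ ∫ x in (0:ℝ)..t, b x :=
    intervalIntegral.continuous_primitive (fun _ _ ↦ hb.intervalIntegrable) 0
  have hBmono : ∀ x y, x ≤ y → ∫ t in (0:ℝ)..x, b t ≤ ∫ t in (0:ℝ)..y, b t := fun x y hxy ↦ by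
    rw [← sub_nonneg, intervalIntegral.integral_interval_sub_left hb.intervalIntegrable
      hb.intervalIntegrable]
    exact intervalIntegral.integral_nonneg hxy fun t _ ↦ hb0 t
  set a : ℕ → ℕ → ℝ := fun n j ↦ (k n)⁻¹ * ω n j with ha
  have ha0 : ∀ n < N, ∀ j ≤ n, 0 ≤ a n j := fun n hn j hj ↦
    mul_nonneg (inv_nonneg.mpr (hk0 n hn).le) (hω0 n hn j (by omega))
  have haanti : ∀ n, n + 1 < N → ∀ j < n, a (n + 1) j ≤ a n j := fun n hn j hj ↦ by
    have hw := integral_comp_sub_antitoneOn hb hbanti (htp j (by omega)).le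
    have hjn := hmono (j + 1) n (by omega) (by omega)
    have hn1 := htp n (by omega)
    exact inv_mul_integral_le_of_forall_le (continuous_integral_comp_sub hb _ _)
      hn1 (htp (n + 1) hn)
      (fun t ht ↦ hw (hjn.trans ht.1) (hjn.trans hn1.le) ht.2)
      (fun t ht ↦ hw (hjn.trans hn1.le) (hjn.trans (hn1.le.trans ht.1)) ht.1)
  have hasum : ∀ n, n + 1 < N →
      ∑ j ∈ range (n + 1), a n j ≤ ∑ j ∈ range (n + 1 + 1), a (n + 1) j := fun n hn ↦ by
    have h := inv_mul_integral_le_of_forall_le (g := fun t ↦ -∫ x in (0:ℝ)..t, b x) hB.neg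
      (htp n (by omega)) (htp (n + 1) hn)
      (fun t ht ↦ neg_le_neg (hBmono _ _ ht.2)) (fun t ht ↦ neg_le_neg (hBmono _ _ ht.1))
    rw [intervalIntegral.integral_neg, intervalIntegral.integral_neg, mul_neg, mul_neg,
      neg_le_neg_iff] at h
    simp only [ha, ← mul_sum]
    rwa [hωsum n (by omega), hωsum (n + 1) hn]
  have haγ : ∀ n < N, ∑ j ∈ range (n + 1), a n j ≤ γ := fun n hn ↦ by
    simp only [ha, ← mul_sum]
    rw [hωsum n hn, inv_mul_le_iff₀ (hk0 n hn)]
    have h := intervalIntegral.integral_mono_on (htp n hn).le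
      (hB.intervalIntegrable (μ := volume) _ _) (intervalIntegrable_const (c := γ))
      fun t _ ↦ hbγ ▸ primitive_le_integral hb hb0 t
    rwa [intervalIntegral.integral_const, smul_eq_mul] at h
  have hωcol : ∀ j < N, ∑ n ∈ range N, ω n j ≤ k j := fun j hj ↦ by
    have h := integral_integral_comp_sub_le hb hb0 hbz (htp j hj).le (tp N)
    rw [← htp0, ← intervalIntegral.sum_integral_adjacent_intervals fun _ _ ↦
      (continuous_integral_comp_sub hb _ _).intervalIntegrable _ _, hbγ] at h
    nlinarith [hk0 j hj]
  -- errors, truncation terms and the potential of the velocity error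
  set E : ℕ → H := fun n ↦ U1 n - u1 (tp n) with hE
  set F : ℕ → H := fun n ↦ U2 n - u2 (tp n) with hF
  set X : ℕ → H := fun n ↦ E (n + 1) - ∑ j ∈ range (n + 1), a n j • E (j + 1) with hX
  set r : ℕ → H := fun n ↦ k n • u2 (tp (n + 1)) - ∫ t in (tp n)..(tp (n + 1)), u2 t with hr
  set Ψ : ℕ → ℕ → H := fun n j ↦ ∫ t in (tp n)..(tp (n + 1)),
    ∫ s in (tp j)..(tp (j + 1)), b (t - s) • (u1 (tp (j + 1)) - u1 s) with hΨ
  set h : ℕ → H := fun n ↦ k n • u1 (tp (n + 1)) - ∫ t in (tp n)..(tp (n + 1)), u1 t with hh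
  set g : ℕ → H := fun n ↦ ∑ j ∈ range (n + 1), Ψ n j - h n with hg
  set W : ℕ → H := fun n ↦ ρ⁻¹ • ∑ i ∈ range n, (g i - k i • X i) with hW
  have hu1c : ContinuousOn u1 (Set.Icc 0 (tp N)) := fun t ht ↦ (hu1 t ht).continuousWithinAt
  have hEstep : ∀ n < N, E (n + 1) - E n - r n = k n • F (n + 1) := fun n hn ↦ by
    have h1 := hU1 (n + 1) (by omega) hn
    have h2 := integral_eq_sub_of_hasDerivWithinAt_Icc (htp n hn).le
      (fun t ht ↦ (hu1 t (hsub n hn ht)).mono (hsub n hn)) (hu1d.mono (hsub n hn))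
    have h3 : ∫ t in (tp n)..(tp (n + 1)), u1d t = ∫ t in (tp n)..(tp (n + 1)), u2 t :=
      intervalIntegral.integral_congr fun t ht ↦
        hu12 t (hsub n hn (by rwa [Set.uIcc_of_le (htp n hn).le] at ht))
    rw [h3] at h2
    simp only [add_tsub_cancel_right, kstep] at h1
    simp only [hE, hF, hr, smul_sub, hk, h2, ← h1]
    abel
  have hFstep : ∀ n < N, ρ • (F (n + 1) - F n) = A (g n - k n • X n) := fun n hn ↦ by
    have h1 := hU2 (n + 1) (by omega) hn
    have h2 := integrated_memory_equation hbβ hb htp0 (fun j hj ↦ (htp j (by omega)).le) A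
      (hu1c.mono (Set.Icc_subset_Icc_right (hmono _ _ hn le_rfl)))
      (fun t ht ↦ (hu2 t (hsub n hn ht)).mono (hsub n hn)) (hu2d.mono (hsub n hn))
      fun t ht ↦ heq t (hsub n hn ht)
    have hq : ∀ j ≤ n, qweight β tp (n + 1) (j + 1) = ω n j := fun j hj ↦
      qweight_succ_eq (htp n hn).le (htp j (by omega)).le (hmono _ _ hj hn.le)
    have hkX : k n • X n = k n • E (n + 1) - ∑ j ∈ range (n + 1), ω n j • E (j + 1) := by
      simp only [hX, ha, smul_sub, smul_sum, smul_smul, mul_inv_cancel_left₀ (hk0 n hn).ne']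
    have hsum : (kstep tp (n + 1) - qweight β tp (n + 1) (n + 1)) • A (U1 (n + 1))
          - ∑ j ∈ Ico 1 (n + 1), qweight β tp (n + 1) j • A (U1 j)
        = A (k n • U1 (n + 1) - ∑ j ∈ range (n + 1), ω n j • U1 (j + 1)) := by
      rw [sum_Ico_eq_sum_range, sum_range_succ, map_sub, map_add, map_sum, hq n le_rfl, sub_smul]
      simp only [add_tsub_cancel_right, map_smul, kstep, add_comm 1]
      rw [sum_congr rfl fun j hj ↦ by rw [hq j (mem_range.mp hj).le]]
      abel
    simp only [add_tsub_cancel_right] at h1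
    rw [add_sub_assoc, hsum, ← h2] at h1
    have h3 : ρ • (F (n + 1) - F n) = ρ • (U2 (n + 1) - U2 n) - ρ • (u2 (tp (n + 1)) - u2 (tp n)) := by
      simp only [hF, smul_sub]; abel
    have h4 : g n - k n • X n = ((∫ t in (tp n)..(tp (n + 1)), u1 t)
        - ∑ j ∈ range (n + 1), (ω n j • u1 (tp (j + 1)) - Ψ n j))
        - (k n • U1 (n + 1) - ∑ j ∈ range (n + 1), ω n j • U1 (j + 1)) := by
      simp only [hg, hh, hkX, hE, smul_sub, sum_sub_distrib]
      abel
    rw [h3, h4, map_sub, sub_eq_sub_iff_add_eq_add, h1, add_comm]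
  have hWstep : ∀ n, ρ • (W (n + 1) - W n) = g n - k n • X n := fun n ↦ by
    simp only [hW]
    rw [← smul_sub, smul_inv_smul₀ hρ.ne', sum_range_succ, add_sub_cancel_left]
  have hFW : ∀ n ≤ N, F n = A (W n) := fun n ↦ by
    induction n with
    | zero => simp [hF, hW, hU20, htp0]
    | succ n ih =>
      intro hn
      have h1 := hFstep n hn
      rw [← hWstep, map_smul, map_sub, ← ih (by omega)] at h1
      simpa using smul_right_injective H hρ.ne' h1
  have hstab := norm_le_of_discrete_energy (E := E) (G := fun n ↦ S (W n)) (X := X) (r := r)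
    (s := fun n ↦ S (g n)) hγ1 hρ (by simp [hE, hU10, htp0]) (by simp [hW]) ha0 haanti hasum haγ
    (fun n _ ↦ rfl) (fun n hn ↦ by
      have hSF : ∀ x, ⟪S x, S (W (n + 1))⟫ = ⟪x, F (n + 1)⟫ := fun x ↦ by
        rw [hS, hSA, hFW (n + 1) hn]
      rw [← real_inner_smul_left, ← map_sub, ← map_smul, hWstep, hSF, hSF, hEstep n hn,
        inner_sub_left, real_inner_smul_left, real_inner_smul_right]
      ring)
  refine hstab.trans ?_
  -- bounds for the truncation terms
  set R : ℕ → ℝ := fun n ↦ ∫ t in (tp n)..(tp (n + 1)), ‖u2d t‖ with hR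
  set D : ℕ → ℝ := fun n ↦ ∫ t in (tp n)..(tp (n + 1)), ‖S (u1d t)‖ with hD
  have hR0 : ∀ n < N, 0 ≤ R n := fun n hn ↦
    intervalIntegral.integral_nonneg (htp n hn).le fun _ _ ↦ norm_nonneg _
  have hD0 : ∀ n < N, 0 ≤ D n := fun n hn ↦
    intervalIntegral.integral_nonneg (htp n hn).le fun _ _ ↦ norm_nonneg _
  have hSu1 : ∀ n < N, ∀ t ∈ Set.Icc (tp n) (tp (n + 1)),
      HasDerivWithinAt (fun t ↦ S (u1 t)) (S (u1d t)) (Set.Icc (tp n) (tp (n + 1))) t :=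
    fun n hn t ht ↦
      S.hasFDerivAt.comp_hasDerivWithinAt t ((hu1 t (hsub n hn ht)).mono (hsub n hn))
  have hSu1d : ContinuousOn (fun t ↦ S (u1d t)) (Set.Icc 0 (tp N)) :=
    S.continuous.comp_continuousOn hu1d
  have hrR : ∀ n < N, ‖r n‖ ≤ k n * R n := fun n hn ↦
    norm_smul_sub_integral_le (htp n hn).le
      (fun t ht ↦ (hu2 t (hsub n hn ht)).mono (hsub n hn)) (hu2d.mono (hsub n hn))
  have hhD : ∀ n < N, ‖S (h n)‖ ≤ k n * D n := fun n hn ↦ by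
    have hint := (hu1c.mono (hsub n hn)).intervalIntegrable_of_Icc (μ := volume) (htp n hn).le
    simp only [hh]
    rw [map_sub, map_smul, ← S.intervalIntegral_comp_comm hint]
    exact norm_smul_sub_integral_le (htp n hn).le (hSu1 n hn) (hSu1d.mono (hsub n hn))
  have hΨD : ∀ n < N, ∀ j < N, ‖S (Ψ n j)‖ ≤ ω n j * D j := fun n hn j hj ↦ by
    have hdiff : ContinuousOn (fun s ↦ u1 (tp (j + 1)) - u1 s) (Set.Icc (tp j) (tp (j + 1))) :=
      continuousOn_const.sub (hu1c.mono (hsub j hj))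
    have hS : S (Ψ n j) = ∫ t in (tp n)..(tp (n + 1)),
        ∫ s in (tp j)..(tp (j + 1)), b (t - s) • (S (u1 (tp (j + 1))) - S (u1 s)) := by
      simp only [hΨ]
      rw [← S.intervalIntegral_comp_comm
        (integrable_integral_comp_sub_smul hb (htp j hj).le hdiff).intervalIntegrable]
      refine intervalIntegral.integral_congr fun t _ ↦ ?_
      rw [← S.intervalIntegral_comp_comm
        (intervalIntegrable_comp_sub_smul hb (htp j hj).le hdiff t)]
      simp only [map_smul, map_sub]
    rw [hS]
    exact norm_integral_integral_comp_sub_smul_le hb hb0 (htp j hj).le (htp n hn).le (hSu1 j hj)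
      (hSu1d.mono (hsub j hj))
  have hgD : ∀ n < N, ‖S (g n)‖ ≤ ∑ j ∈ range N, ω n j * D j + k n * D n := fun n hn ↦ by
    simp only [hg]
    rw [map_sub, map_sum]
    refine (norm_sub_le _ _).trans (add_le_add ?_ (hhD n hn))
    refine (norm_sum_le_of_le _ fun j hj ↦ hΨD n hn j ((mem_range.mp hj).trans_le hn)).trans ?_
    exact sum_le_sum_of_subset_of_nonneg (range_mono hn) fun j hj _ ↦
      mul_nonneg (hω0 n hn j (mem_range.mp hj)) (hD0 j (mem_range.mp hj))
  have hmem : ∑ n ∈ range N, ∑ j ∈ range N, ω n j * D j ≤ ∑ j ∈ range N, k j * D j := by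
    rw [sum_comm]
    refine sum_le_sum fun j hj ↦ ?_
    rw [← sum_mul]
    exact mul_le_mul_of_nonneg_right (hωcol j (mem_range.mp hj)) (hD0 j (mem_range.mp hj))
  have htotal : ∑ n ∈ range N, (‖r n‖ + ‖S (g n)‖) ≤ 2 * ∑ n ∈ range N, k n * (R n + D n) := by
    have h1 : ∑ n ∈ range N, (‖r n‖ + ‖S (g n)‖)
        ≤ ∑ n ∈ range N, (k n * R n + (∑ j ∈ range N, ω n j * D j + k n * D n)) :=
      sum_le_sum fun n hn ↦ add_le_add (hrR n (mem_range.mp hn)) (hgD n (mem_range.mp hn))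
    have h2 : 0 ≤ ∑ n ∈ range N, k n * R n := sum_nonneg fun n hn ↦
      mul_nonneg (hk0 n (mem_range.mp hn)).le (hR0 n (mem_range.mp hn))
    simp only [mul_add, sum_add_distrib] at h1 ⊢
    linarith
  have hrhs : ∑ n ∈ Icc 1 N, kstep tp n
        * ∫ t in (tp (n - 1))..(tp n), (‖u2d t‖ + ‖S (u1d t)‖)
      = ∑ n ∈ range N, k n * (R n + D n) := by
    rw [sum_Icc_one_eq_sum_range]
    refine sum_congr rfl fun n hn ↦ ?_
    have hn := mem_range.mp hn
    simp only [kstep, add_tsub_cancel_right, hR, hD]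
    rw [intervalIntegral.integral_add
      ((hu2d.norm.mono (hsub n hn)).intervalIntegrable_of_Icc (htp n hn).le)
      ((hSu1d.norm.mono (hsub n hn)).intervalIntegrable_of_Icc (htp n hn).le)]
  rw [hrhs]
  calc 4 / min (1 - γ) ρ * ∑ n ∈ range N, (‖r n‖ + ‖S (g n)‖)
      ≤ 4 / min (1 - γ) ρ * (2 * ∑ n ∈ range N, k n * (R n + D n)) :=
        mul_le_mul_of_nonneg_left htotal
          (div_nonneg (by norm_num) (le_min (by linarith) hρ.le))
    _ = 8 / min (1 - γ) ρ * ∑ n ∈ range N, k n * (R n + D n) := by ring
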